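/- Every computable probability distribution over the natural numbers is representable: if D : ℕ → [0,1] is a computable probability distribution, then there exists a closed term M of Λ⊕ such that ⟦M⟧v is supported on Scott numerals and ⟦M⟧v(⌜n⌝) = D(n) for every n ∈ ℕ. -/

import Mathlib

open scoped ENNReal

/-- Terms of Λ⊕ (and of Λ⊕⁺), in de Bruijn notation: variables, abstractions,
applications and binary (probabilistic) sums.  De Bruijn indices realize
"terms up to renaming of bound variables". -/
inductive Term : Type
  | var : ℕ → Term
  | lam : Term → Term
  | app : Term → Term → Term
  | choice : Term → Term → Term
  deriving DecidableEq

namespace Term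

/-- Values: variables and abstractions. -/
inductive IsValue : Term → Prop
  | var (n : ℕ) : IsValue (var n)
  | lam (M : Term) : IsValue (lam M)

/-- Boolean value test. -/
def isVal : Term → Bool
  | var _ => true
  | lam _ => true
  | _ => false

/-- Shifting of de Bruijn indices: add `d` to all indices `≥ c`. -/
def shift (d c : ℕ) : Term → Term
  | var n => if n < c then var n else var (n + d)
  | lam M => lam (shift d (c + 1) M)
  | app M N => app (shift d c M) (shift d c N)
  | choice M N => choice (shift d c M) (shift d c N)

/-- Capture-avoiding substitution `M[j := N]` (the variable `j` is consumed and
higher indices are decremented, as in a β-step). -/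
def subst : Term → ℕ → Term → Term
  | var n, j, N => if n = j then shift j 0 N else if j < n then var (n - 1) else var n
  | lam M, j, N => lam (subst M (j + 1) N)
  | app M L, j, N => app (subst M j N) (subst L j N)
  | choice M L, j, N => choice (subst M j N) (subst L j N)

/-- All free indices are `< n`. -/
def closedUnder : Term → ℕ → Prop
  | var m, n => m < n
  | lam M, n => closedUnder M (n + 1)
  | app M N, n => closedUnder M n ∧ closedUnder N n
  | choice M N, n => closedUnder M n ∧ closedUnder N n

/-- Closed terms: no free variables. -/
def Closed (M : Term) : Prop := closedUnder M 0

end Term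

/-- (Sub)distributions are represented as functions from terms into `ℝ≥0∞`;
genuine distributions (`IsDist`) are supported on values and have mass `≤ 1`. -/
abbrev PDist := Term → ℝ≥0∞

/-- The sum (total mass) `Σ𝒟` of a distribution. -/
noncomputable def dsum (D : PDist) : ℝ≥0∞ := ∑' M, D M

/-- The support of a distribution. -/
def dsupp (D : PDist) : Set Term := {M | D M ≠ 0}

/-- The everywhere-zero distribution `∅`. -/
noncomputable def dzero : PDist := fun _ => 0

/-- The Dirac distribution `{V^1}`. -/
noncomputable def dirac (V : Term) : PDist := fun M => if M = V then 1 else 0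

/-- Being a genuine (sub)probability distribution: supported on values, with
total mass at most one. -/
def IsDist (D : PDist) : Prop := (∀ M, D M ≠ 0 → M.IsValue) ∧ dsum D ≤ 1

/-- Call-by-value reduction `↦v`, relating a term to the (equiprobable) finite
sequence of its possible reducts. -/
inductive RedV : Term → List Term → Prop
  | beta {M V : Term} : V.IsValue → RedV (.app (.lam M) V) [M.subst 0 V]
  | choice {V W : Term} : V.IsValue → W.IsValue → RedV (.choice V W) [V, W]
  | appL {M N : Term} {Ls : List Term} :
      RedV M Ls → RedV (.app M N) (Ls.map (fun L => .app L N))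
  | appR {V M : Term} {Ns : List Term} :
      V.IsValue → RedV M Ns → RedV (.app V M) (Ns.map (fun L => .app V L))
  | choiceL {M N : Term} {Ls : List Term} :
      RedV M Ls → RedV (.choice M N) (Ls.map (fun L => .choice L N))
  | choiceR {V M : Term} {Ns : List Term} :
      V.IsValue → RedV M Ns → RedV (.choice V M) (Ns.map (fun L => .choice V L))

/-- Call-by-name reduction `↦n`. -/
inductive RedN : Term → List Term → Prop
  | beta {M N : Term} : RedN (.app (.lam M) N) [M.subst 0 N]
  | choice {M N : Term} : RedN (.choice M N) [M, N]
  | appL {M N : Term} {Ls : List Term} :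
      RedN M Ls → RedN (.app M N) (Ls.map (fun L => .app L N))

/-- The inductive small-step convergence relation `⇒`, parametric in the
underlying reduction relation: any term evaluates to `∅`; a value `V`
evaluates to `{V^1}`; and if `M ↦ N₁,…,Nₙ` and `Nᵢ ⇒ 𝒟ᵢ` then
`M ⇒ Σᵢ (1/n)𝒟ᵢ`. -/
inductive Conv (Red : Term → List Term → Prop) : Term → PDist → Prop
  | bot (M : Term) : Conv Red M dzero
  | val {V : Term} : V.IsValue → Conv Red V (dirac V)
  | step {M : Term} {Ns : List Term} (Ds : Fin Ns.length → PDist) :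
      Red M Ns → (∀ i, Conv Red (Ns.get i) (Ds i)) →
      Conv Red M (fun W => (∑ i, Ds i W) / (Ns.length : ℝ≥0∞))

/-- Call-by-value small-step convergence `⇒v`. -/
def SmallV : Term → PDist → Prop := Conv RedV

/-- Call-by-name small-step convergence `⇒n`. -/
def SmallN : Term → PDist → Prop := Conv RedN

/-- The small-step semantics `⟦M⟧`: the pointwise supremum of all distributions
derivable for `M`. -/
noncomputable def semOf (S : Term → PDist → Prop) (M : Term) : PDist :=
  fun W => ⨆ (D : PDist) (_ : S M D), D W

/-- Call-by-value small-step semantics `⟦M⟧v`. -/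
noncomputable def semV : Term → PDist := semOf SmallV

/-- Call-by-name small-step semantics `⟦M⟧n`. -/
noncomputable def semN : Term → PDist := semOf SmallN

/-- One-step unfolding of the divergence inference system: a value diverges
with probability `0`; if `M ↦ N₁,…,Nₙ` and `Nᵢ` diverges with probability
`pᵢ`, then `M` diverges with probability `Σᵢ (1/n)pᵢ`. -/
def DivStep (Red : Term → List Term → Prop) (R : Term → ℝ≥0∞ → Prop)
    (M : Term) (p : ℝ≥0∞) : Prop :=
  (M.IsValue ∧ p = 0) ∨
    ∃ (Ns : List Term) (ps : Fin Ns.length → ℝ≥0∞),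
      Red M Ns ∧ (∀ i, R (Ns.get i) (ps i)) ∧ p = (∑ i, ps i) / (Ns.length : ℝ≥0∞)

/-- The coinductively-defined divergence relation `⇓div`: the union of all
consistent relations between terms and probabilities in `[0,1]`. -/
def Diverges (Red : Term → List Term → Prop) (M : Term) (p : ℝ≥0∞) : Prop :=
  ∃ R : Term → ℝ≥0∞ → Prop,
    (∀ N q, R N q → q ≤ 1 ∧ DivStep Red R N q) ∧ R M p

/-- Call-by-value divergence `⇓div`. -/
def DivV : Term → ℝ≥0∞ → Prop := Diverges RedV

/-- Call-by-name divergence `⇓div,n`. -/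
def DivN : Term → ℝ≥0∞ → Prop := Diverges RedN

/-- One-step unfolding of the call-by-value big-step inference system. -/
def BigVStep (R : Term → PDist → Prop) (M : Term) (D : PDist) : Prop :=
  (M.IsValue ∧ D = dirac M) ∨
  (∃ (N L : Term) (E F : PDist) (G : Term → Term → PDist),
      M = .app N L ∧ R N E ∧ R L F ∧
      (∀ P V, E (.lam P) ≠ 0 → V.IsValue → F V ≠ 0 → R (P.subst 0 V) (G P V)) ∧
      D = fun W => ∑' (P : Term), ∑' (V : Term), E (.lam P) * F V * G P V W) ∨
  (∃ (N L : Term) (E F : PDist),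
      M = .choice N L ∧ R N E ∧ R L F ∧
      D = fun W => (E W * dsum F + F W * dsum E) / 2)

/-- The coinductive call-by-value big-step relation `⇓v`: the union of all
consistent relations between terms and distributions. -/
def BigV (M : Term) (D : PDist) : Prop :=
  ∃ R : Term → PDist → Prop,
    (∀ N E, R N E → IsDist E ∧ BigVStep R N E) ∧ R M D

/-- One-step unfolding of the call-by-name big-step inference system. -/
def BigNStep (R : Term → PDist → Prop) (M : Term) (D : PDist) : Prop :=
  (M.IsValue ∧ D = dirac M) ∨
  (∃ (N L : Term) (E : PDist) (F : Term → PDist),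
      M = .app N L ∧ R N E ∧
      (∀ P, E (.lam P) ≠ 0 → R (P.subst 0 L) (F P)) ∧
      D = fun W => ∑' (P : Term), E (.lam P) * F P W) ∨
  (∃ (N L : Term) (E F : PDist),
      M = .choice N L ∧ R N E ∧ R L F ∧ D = fun W => (E W + F W) / 2)

/-- The coinductive call-by-name big-step relation `⇓n`. -/
def BigN (M : Term) (D : PDist) : Prop :=
  ∃ R : Term → PDist → Prop,
    (∀ N E, R N E → IsDist E ∧ BigNStep R N E) ∧ R M D

/-- Big-step semantics `⟪M⟫`: the pointwise infimum of all distributions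
derivable for `M` in a big-step system. -/
noncomputable def bigSemOf (B : Term → PDist → Prop) (M : Term) : PDist :=
  fun W => ⨅ (D : PDist) (_ : B M D), D W

open Term in
/-- The call-by-value CPS translation `⟨·⟩` of Plotkin, extended to binary
choice (de Bruijn version; the continuation variables `ε, α, β, γ` of `Λ⊕⁺`
are rendered as the extra binders introduced by the translation). -/
def cps : Term → Term
  | .var n => .lam (.app (.var 0) (.var (n + 1)))
  | .lam M => .lam (.app (.var 0) (.lam (shift 1 1 (cps M))))
  | .app M N =>
      .lam (.app (shift 1 0 (cps M))
        (.lam (.app (shift 2 0 (cps N))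
          (.lam (.app (.app (.var 1) (.var 0)) (.var 2))))))
  | .choice M N =>
      .lam (.app (shift 1 0 (cps M))
        (.lam (.app (shift 2 0 (cps N))
          (.lam (.app
            (.choice (.lam (.app (.var 0) (.var 2))) (.lam (.app (.var 0) (.var 1))))
            (.var 2))))))

/-- The map `Ψ` on values: `Ψ(x) = x`, `Ψ(λx.M) = λx.⟨M⟩` (extended
structurally to all terms). -/
def psi : Term → Term
  | .var n => .var n
  | .lam M => .lam (cps M)
  | .app M N => .app (psi M) (psi N)
  | .choice M N => .choice (psi M) (psi N)

/-- The pushforward of a distribution along `Ψ`: `Ψ(𝒟)(W) = Σ_{V : Ψ(V)=W} 𝒟(V)`. -/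
noncomputable def pushPsi (D : PDist) : PDist :=
  fun W => ∑' V : Term, if psi V = W then D V else 0

open Term in
/-- The call-by-name CPS translation `⌈·⌉` (de Bruijn version). -/
def cpn : Term → Term
  | .var n => .var n
  | .lam M => .lam (.app (.var 0) (.lam (shift 1 1 (cpn M))))
  | .app M N =>
      .lam (.app (shift 1 0 (cpn M))
        (.lam (.app (.app (.var 0) (shift 2 0 (cpn N))) (.var 1))))
  | .choice M N =>
      .lam (.app
        (.choice (.lam (.app (shift 2 0 (cpn M)) (.var 0)))
                 (.lam (.app (shift 2 0 (cpn N)) (.var 0))))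
        (.var 0))

/-- The map `Φ` on values: `Φ(x) = x(λy.y)`, `Φ(λx.M) = λx.⌈M⌉` (extended
structurally to all terms). -/
def phi : Term → Term
  | .var n => .app (.var n) (.lam (.var 0))
  | .lam M => .lam (cpn M)
  | .app M N => .app (phi M) (phi N)
  | .choice M N => .choice (phi M) (phi N)

/-- The pushforward of a distribution along `Φ`. -/
noncomputable def pushPhi (D : PDist) : PDist :=
  fun W => ∑' V : Term, if phi V = W then D V else 0

open Term in
/-- Plotkin's infix operator `M : K` for the call-by-value CPS translation,
extended to binary choice. -/
def colonV : Term → Term → Term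
  | .var n, K => .app K (psi (.var n))
  | .lam M, K => .app K (psi (.lam M))
  | .app L P, K =>
      if L.isVal then
        if P.isVal then .app (.app (psi L) (psi P)) K
        else colonV P (.lam (.app (.app (shift 1 0 (psi L)) (.var 0)) (shift 1 0 K)))
      else
        colonV L (.lam (.app (shift 1 0 (cps P))
          (.lam (.app (.app (.var 1) (.var 0)) (shift 2 0 K)))))
  | .choice L P, K =>
      if L.isVal then
        if P.isVal then
          .app (.choice (.lam (.app (.var 0) (shift 1 0 (psi L))))
                        (.lam (.app (.var 0) (shift 1 0 (psi P))))) K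
        else
          colonV P (.lam (.app
            (.choice (.lam (.app (.var 0) (shift 2 0 (psi L))))
                     (.lam (.app (.var 0) (.var 1))))
            (shift 1 0 K)))
      else
        colonV L (.lam (.app (shift 1 0 (cps P))
          (.lam (.app
            (.choice (.lam (.app (.var 0) (.var 2))) (.lam (.app (.var 0) (.var 1))))
            (shift 2 0 K)))))

/-- A deterministic reduction step: a reduction whose right-hand side is a
one-element sequence. -/
def DetStepN (M N : Term) : Prop := RedN M [N]

/-- Scott numerals: `⌜0⌝ = λxy.x`, `⌜n+1⌝ = λxy.y⌜n⌝`. -/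
def scott : ℕ → Term
  | 0 => .lam (.lam (.var 1))
  | n + 1 => .lam (.lam (.app (.var 0) (scott n)))

/-- The binary string (of length `n`) made of the first `n` digits of the
binary expansion of `x ∈ [0,1]`. -/
noncomputable def binApprox (x : ℝ≥0∞) (n : ℕ) : List Bool :=
  (List.range n).map (fun i => decide (⌊x.toReal * 2 ^ (i + 1)⌋ % 2 = 1))

/-- A distribution `D : ℕ → [0,1]` is computable when its approximating
function `(a, n) ↦` first `n` binary digits of `D a` is computable. -/
def ComputableDist (D : ℕ → ℝ≥0∞) : Prop :=
  Computable fun p : ℕ × ℕ => binApprox (D p.1) p.2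


namespace Term

theorem closedUnder_mono {M : Term} {m n : ℕ} (h : M.closedUnder m) (hmn : m ≤ n) :
    M.closedUnder n := by
  induction M generalizing m n with
  | var k => simp only [closedUnder] at *; omega
  | lam M ih => exact ih (m := m + 1) (n := n + 1) h (by omega)
  | app M N ih1 ih2 => exact ⟨ih1 h.1 hmn, ih2 h.2 hmn⟩
  | choice M N ih1 ih2 => exact ⟨ih1 h.1 hmn, ih2 h.2 hmn⟩

theorem closedUnder_shift {M : Term} {d n c : ℕ} (h : M.closedUnder n) (hc : n ≤ c) :
    M.shift d c = M := by
  induction M generalizing n c with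
  | var k => simp only [closedUnder, shift] at *; rw [if_pos (by omega)]
  | lam M ih => simp only [shift]; rw [ih (n := n + 1) h (by omega)]
  | app M N ih1 ih2 => simp only [shift]; rw [ih1 h.1 hc, ih2 h.2 hc]
  | choice M N ih1 ih2 => simp only [shift]; rw [ih1 h.1 hc, ih2 h.2 hc]

theorem closedUnder_subst {M : Term} {j n : ℕ} {N : Term} (h : M.closedUnder n) (hc : n ≤ j) :
    M.subst j N = M := by
  induction M generalizing n j with
  | var k => simp only [closedUnder, subst] at *; rw [if_neg (by omega), if_neg (by omega)]
  | lam M ih => simp only [subst]; rw [ih (n := n + 1) h (by omega)]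
  | app M N ih1 ih2 => simp only [subst]; rw [ih1 h.1 hc, ih2 h.2 hc]
  | choice M N ih1 ih2 => simp only [subst]; rw [ih1 h.1 hc, ih2 h.2 hc]

theorem Closed.under {M : Term} (h : M.Closed) (n : ℕ) : M.closedUnder n :=
  closedUnder_mono h (Nat.zero_le n)

theorem Closed.shift {M : Term} (h : M.Closed) (d c : ℕ) : M.shift d c = M :=
  closedUnder_shift h (Nat.zero_le c)

theorem Closed.subst {M : Term} (h : M.Closed) (j : ℕ) (N : Term) : M.subst j N = M :=
  closedUnder_subst h (Nat.zero_le j)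

end Term

open Term

theorem scott_closed (n : ℕ) : (scott n).Closed := by
  induction n with
  | zero => simp [scott, Closed, closedUnder]
  | succ n ih => simp [scott, Closed, closedUnder, ih.under]

theorem scott_val (n : ℕ) : (scott n).IsValue := by
  cases n <;> exact .lam _

/-- Scott encoding of lists of natural numbers. -/
def encL : List ℕ → Term
  | [] => .lam (.lam (.var 1))
  | n :: v => .lam (.lam (.app (.app (.var 0) (scott n)) (encL v)))

theorem encL_closed (v : List ℕ) : (encL v).Closed := by
  induction v with
  | nil => simp [encL, Closed, closedUnder]
  | cons n v ih => simp [encL, Closed, closedUnder, ih.under, (scott_closed n).under]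

theorem encL_val (n : List ℕ) : (encL n).IsValue := by
  cases n <;> exact .lam _

/-- Many deterministic call-by-value steps. -/
def Steps : Term → Term → Prop := Relation.ReflTransGen (fun M N => RedV M [N])

namespace Steps

theorem refl {M : Term} : Steps M M := Relation.ReflTransGen.refl

theorem trans {M N L : Term} (h : Steps M N) (h' : Steps N L) : Steps M L :=
  Relation.ReflTransGen.trans h h'

theorem appL {M M' : Term} (h : Steps M M') (N : Term) : Steps (.app M N) (.app M' N) := by
  induction h with
  | refl => exact refl
  | tail _ h ih => exact Relation.ReflTransGen.tail ih (RedV.appL (N := N) h)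

theorem appR {V M M' : Term} (hV : V.IsValue) (h : Steps M M') :
    Steps (.app V M) (.app V M') := by
  induction h with
  | refl => exact refl
  | tail _ h ih => exact Relation.ReflTransGen.tail ih (RedV.appR hV h)

theorem beta {B V : Term} (hV : V.IsValue) : Steps (.app (.lam B) V) (B.subst 0 V) :=
  Relation.ReflTransGen.single (RedV.beta hV)

theorem beta' {B V W : Term} (hV : V.IsValue) (h : Steps (B.subst 0 V) W) :
    Steps (.app (.lam B) V) W := (beta hV).trans h

theorem app {M M' N N' W : Term} (hM : Steps M M') (hN : Steps N N') (hM' : M'.IsValue)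
    (h : Steps (.app M' N') W) : Steps (.app M N) W :=
  ((hM.appL N).trans (appR hM' hN)).trans h

theorem argBeta {B N N' W : Term} (hN : Steps N N') (hN' : N'.IsValue)
    (h : Steps (B.subst 0 N') W) : Steps (.app (.lam B) N) W :=
  app refl hN (.lam _) (beta' hN' h)

end Steps

/-- Head of a list. -/
def HD : Term := .lam (.app (.app (.var 0) (scott 0)) (.lam (.lam (.var 1))))
/-- Tail of a list. -/
def TL : Term := .lam (.app (.app (.var 0) (encL [])) (.lam (.lam (.var 0))))
/-- List constructor. -/
def CONS : Term := .lam (.lam (.lam (.lam (.app (.app (.var 0) (.var 3)) (.var 2)))))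
/-- Successor. -/
def SUCC : Term := .lam (.lam (.lam (.app (.var 0) (.var 2))))
/-- Identity. -/
def IDT : Term := .lam (.var 0)

theorem HD_closed : HD.Closed := by
  simp [HD, Closed, closedUnder, (scott_closed _).under]
theorem TL_closed : TL.Closed := by
  simp [TL, Closed, closedUnder, (encL_closed _).under]
theorem CONS_closed : CONS.Closed := by simp [CONS, Closed, closedUnder]
theorem SUCC_closed : SUCC.Closed := by simp [SUCC, Closed, closedUnder]
theorem IDT_closed : IDT.Closed := by simp [IDT, Closed, closedUnder]

theorem natcase_zero {X Y : Term} (hX : X.IsValue) (hXc : X.Closed) (hY : Y.IsValue) :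
    Steps (.app (.app (scott 0) X) Y) X := by
  refine Steps.trans (Steps.appL (Steps.beta hX) Y) ?_
  refine Steps.trans (Steps.beta hY) ?_
  simp [subst, hXc.shift, hXc.subst, Steps.refl]

theorem natcase_succ {X Y : Term} (n : ℕ) (hX : X.IsValue) (hY : Y.IsValue) :
    Steps (.app (.app (scott (n + 1)) X) Y) (.app Y (scott n)) := by
  refine Steps.trans (Steps.appL (Steps.beta hX) Y) ?_
  refine Steps.trans (Steps.beta hY) ?_
  have : Y.shift 0 0 = Y := by
    have : ∀ c, Y.shift 0 c = Y := by
      clear hX hY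
      induction Y <;> simp_all [Term.shift]
    exact this 0
  simp [subst, (scott_closed n).subst, this, Steps.refl]

theorem listcase_nil {X Y : Term} (hX : X.IsValue) (hXc : X.Closed) (hY : Y.IsValue) :
    Steps (.app (.app (encL []) X) Y) X := natcase_zero hX hXc hY

theorem listcase_cons {X Y : Term} (n : ℕ) (v : List ℕ) (hX : X.IsValue) (hY : Y.IsValue)
    (hYc : Y.Closed) :
    Steps (.app (.app (encL (n :: v)) X) Y) (.app (.app Y (scott n)) (encL v)) := by
  refine Steps.trans (Steps.appL (Steps.beta hX) Y) ?_
  refine Steps.trans (Steps.beta hY) ?_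
  simp [subst, (scott_closed n).subst, (encL_closed v).subst, hYc.shift, Steps.refl]

theorem HD_spec (v : List ℕ) : Steps (.app HD (encL v)) (scott v.headI) := by
  refine Steps.beta' (encL_val v) ?_
  simp only [subst, (encL_closed v).shift, (scott_closed _).subst]
  cases v with
  | nil => exact listcase_nil (scott_val 0) (scott_closed 0) (.lam _)
  | cons n v =>
    refine (listcase_cons n v (scott_val 0) (.lam _) (by simp [Closed, closedUnder])).trans ?_
    refine Steps.trans (Steps.appL (Steps.beta (scott_val n)) _) ?_
    refine Steps.beta' (encL_val v) ?_
    simp [subst, (scott_closed n).shift, (scott_closed n).subst, Steps.refl]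

theorem TL_spec (v : List ℕ) : Steps (.app TL (encL v)) (encL v.tail) := by
  refine Steps.beta' (encL_val v) ?_
  simp only [subst, (encL_closed _).shift, (encL_closed _).subst]
  cases v with
  | nil => exact listcase_nil (encL_val []) (encL_closed []) (.lam _)
  | cons n v =>
    refine (listcase_cons n v (encL_val []) (.lam _) (by simp [Closed, closedUnder])).trans ?_
    refine Steps.trans (Steps.appL (Steps.beta (scott_val n)) _) ?_
    refine Steps.beta' (encL_val v) ?_
    simp [subst, (encL_closed v).shift, Steps.refl]

theorem CONS_spec (n : ℕ) (v : List ℕ) :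
    Steps (.app (.app CONS (scott n)) (encL v)) (encL (n :: v)) := by
  refine Steps.trans (Steps.appL (Steps.beta (scott_val n)) _) ?_
  refine Steps.beta' (encL_val v) ?_
  simp [subst, (encL_closed v).shift, (scott_closed n).shift, (scott_closed n).subst, encL,
    Steps.refl]

theorem CONS_eval {M N : Term} {n : ℕ} {v : List ℕ} (hM : Steps M (scott n))
    (hN : Steps N (encL v)) : Steps (.app (.app CONS M) N) (encL (n :: v)) := by
  refine Steps.trans (Steps.appL (Steps.appR (.lam _) hM) _) ?_
  refine Steps.trans (Steps.appL (Steps.beta (scott_val n)) _) ?_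
  refine Steps.argBeta hN (encL_val v) ?_
  simp [subst, (encL_closed v).shift, (scott_closed n).shift, (scott_closed n).subst, encL,
    Steps.refl]

theorem SUCC_spec (n : ℕ) : Steps (.app SUCC (scott n)) (scott (n + 1)) := by
  refine Steps.beta' (scott_val n) ?_
  simp [subst, (scott_closed n).shift, scott, Steps.refl]

open Turing.ToPartrec

/-- Body of the recursive functional used to interpret `Code.fix`. -/
def fixB (F : Term) : Term :=
  .lam (.app (.lam (.app (.app (.app (.app HD (.var 0))
      (.lam (.app TL (.var 1))))
      (.lam (.lam (.app (.app (.var 4) (.var 4)) (.app TL (.var 2)))))) IDT))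
    (.app F (.var 0)))

/-- The recursive functional used to interpret `Code.fix`. -/
def fixW (F : Term) : Term := .lam (fixB F)

/-- The unfolded loop. -/
def fixL (F : Term) : Term := (fixB F).subst 0 (fixW F)

theorem fixL_val (F : Term) : (fixL F).IsValue := .lam _

theorem fixW_self (F : Term) : Steps (.app (fixW F) (fixW F)) (fixL F) := Steps.beta (.lam _)

/-- Compilation of codes to closed lambda terms acting on encoded lists. -/
def compile : Code → Term
  | .zero' => .lam (.app (.app CONS (scott 0)) (.var 0))
  | .succ => .lam (.app (.app CONS (.app SUCC (.app HD (.var 0)))) (encL []))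
  | .tail => TL
  | .cons f fs => .lam (.app (.app CONS (.app HD (.app (compile f) (.var 0))))
      (.app (compile fs) (.var 0)))
  | .comp f g => .lam (.app (compile f) (.app (compile g) (.var 0)))
  | .case f g => .lam (.app (.app (.app (.app HD (.var 0))
      (.lam (.app (compile f) (.app TL (.var 1)))))
      (.lam (.lam (.app (compile g) (.app (.app CONS (.var 1)) (.app TL (.var 2))))))) IDT)
  | .fix f => .lam (.app (.app (fixW (compile f)) (fixW (compile f))) (.var 0))

theorem fixW_closed {F : Term} (h : F.Closed) : (fixW F).Closed := by
  simp [fixW, fixB, Closed, closedUnder, h.under, HD_closed.under, TL_closed.under, IDT_closed.under]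

theorem compile_closed (c : Code) : (compile c).Closed := by
  have e := fun (M : Term) (h : M.closedUnder 0) (n : ℕ) => Closed.under (M := M) h n
  induction c <;> simp only [Closed] at * <;>
  simp_all [compile, closedUnder, HD_closed.under, TL_closed.under, IDT_closed.under,
    CONS_closed.under, SUCC_closed.under, (scott_closed _).under, (encL_closed _).under]
  exact (fixW_closed (by assumption)).under _

theorem compile_val (c : Code) : (compile c).IsValue := by
  cases c <;> exact .lam _

/-- Case analysis on a numeral, with thunked branches. -/
theorem thunk_zero {H B Y W : Term} (hH : Steps H (scott 0))
    (hB : (Term.lam B).Closed) (hY : Y.IsValue) (h : Steps (B.subst 0 IDT) W) :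
    Steps (.app (.app (.app H (.lam B)) Y) IDT) W := by
  refine Steps.trans (((hH.appL _).appL _).appL _) ?_
  refine Steps.trans ((natcase_zero (.lam _) hB hY).appL _) ?_
  exact Steps.beta' (.lam _) h

theorem thunk_succ {H X B W : Term} {n : ℕ} (hH : Steps H (scott (n + 1)))
    (hX : X.IsValue) (h : Steps ((B.subst 1 (scott n)).subst 0 IDT) W) :
    Steps (.app (.app (.app H X) (.lam (.lam B))) IDT) W := by
  refine Steps.trans (((hH.appL _).appL _).appL _) ?_
  refine Steps.trans ((natcase_succ n hX (.lam _)).appL _) ?_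
  refine Steps.trans ((Steps.beta (scott_val n)).appL _) ?_
  exact Steps.beta' (.lam _) h

theorem app_eval {F M : Term} {v w : List ℕ} (hF : F.IsValue) (hM : Steps M (encL v))
    (h : Steps (.app F (encL v)) (encL w)) : Steps (.app F M) (encL w) :=
  (Steps.appR hF hM).trans h

theorem HD_eval {M : Term} {v : List ℕ} (hM : Steps M (encL v)) :
    Steps (.app HD M) (scott v.headI) :=
  (Steps.appR (.lam _) hM).trans (HD_spec v)

theorem fix_unfold {F : Term} (hF : F.Closed) {v w : List ℕ}
    (h : Steps (.app F (encL v)) (encL w)) :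
    Steps (.app (fixL F) (encL v)) (.app (.app (.app (.app HD (encL w))
      (.lam (.app TL (encL w))))
      (.lam (.lam (.app (.app (fixW F) (fixW F)) (.app TL (encL w)))))) IDT) := by
  refine Steps.beta' (encL_val v) ?_
  have hW := fixW_closed hF
  simp only [subst, hF.subst, HD_closed.subst, TL_closed.subst, IDT_closed.subst]
  refine Steps.argBeta (by simpa [Term.subst, hF.subst, (encL_closed v).shift] using h) (encL_val w) ?_
  simp [subst, HD_closed.subst, TL_closed.subst, IDT_closed.subst, hW.subst, hW.shift,
    (encL_closed w).shift, Steps.refl]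

theorem fix_unfold_zero {F : Term} (hF : F.Closed) {v w : List ℕ}
    (h : Steps (.app F (encL v)) (encL w)) (hw : w.headI = 0) :
    Steps (.app (fixL F) (encL v)) (encL w.tail) := by
  refine (fix_unfold hF h).trans ?_
  have hd := HD_spec w
  rw [hw] at hd
  refine thunk_zero hd ?_ (.lam _) ?_
  · simp [Closed, closedUnder, TL_closed.under, (encL_closed w).under]
  · simp only [subst, TL_closed.subst, (encL_closed w).subst]
    exact TL_spec w

theorem fix_unfold_succ {F : Term} (hF : F.Closed) {v w u : List ℕ}
    (h : Steps (.app F (encL v)) (encL w)) (hw : w.headI ≠ 0)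
    (hu : Steps (.app (fixL F) (encL w.tail)) (encL u)) :
    Steps (.app (fixL F) (encL v)) (encL u) := by
  refine (fix_unfold hF h).trans ?_
  have hW := fixW_closed hF
  have hd := HD_spec w
  obtain ⟨n, hn⟩ := Nat.exists_eq_succ_of_ne_zero hw
  rw [hn] at hd
  refine thunk_succ hd (.lam _) ?_
  simp only [subst, TL_closed.subst, (encL_closed w).subst, hW.subst]
  exact Steps.app (fixW_self F) (TL_spec w) (fixL_val F) hu

theorem compile_spec (c : Code) {v w : List ℕ} (h : w ∈ c.eval v) :
    Steps (.app (compile c) (encL v)) (encL w) := by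
  induction c generalizing v w with
  | zero' =>
    simp only [Code.zero'_eval, Part.pure_eq_some, Part.mem_some_iff] at h
    subst h
    refine Steps.beta' (encL_val v) ?_
    simp only [subst, CONS_closed.subst, (scott_closed _).subst, (encL_closed v).shift, reduceIte]
    exact CONS_spec 0 v
  | succ =>
    simp only [Code.succ_eval, Part.pure_eq_some, Part.mem_some_iff] at h
    subst h
    refine Steps.beta' (encL_val v) ?_
    simp only [subst, CONS_closed.subst, SUCC_closed.subst, HD_closed.subst,
      (encL_closed _).subst, (encL_closed v).shift, reduceIte]
    exact CONS_eval ((Steps.appR (.lam _) (HD_spec v)).trans (SUCC_spec _)) Steps.refl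
  | tail =>
    simp only [Code.tail_eval, Part.pure_eq_some, Part.mem_some_iff] at h
    subst h
    exact TL_spec v
  | cons f fs ihf ihfs =>
    rw [Code.cons_eval] at h
    obtain ⟨a, ha, h⟩ := Part.mem_bind_iff.1 h
    obtain ⟨b, hb, h⟩ := Part.mem_bind_iff.1 h
    cases Part.mem_some_iff.1 h
    refine Steps.beta' (encL_val v) ?_
    simp only [subst, CONS_closed.subst, HD_closed.subst, (compile_closed _).subst,
      (encL_closed v).shift, reduceIte]
    exact CONS_eval (HD_eval (ihf ha)) (ihfs hb)
  | comp f g ihf ihg =>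
    rw [Code.comp_eval] at h
    obtain ⟨a, ha, hb⟩ := Part.mem_bind_iff.1 h
    refine Steps.beta' (encL_val v) ?_
    simp only [subst, (compile_closed _).subst, (encL_closed v).shift, reduceIte]
    exact app_eval (compile_val f) (ihg ha) (ihf hb)
  | case f g ihf ihg =>
    simp only [Code.case_eval] at h
    refine Steps.beta' (encL_val v) ?_
    simp only [subst, CONS_closed.subst, HD_closed.subst, TL_closed.subst, IDT_closed.subst,
      (compile_closed _).subst, (encL_closed v).shift, reduceIte]
    have hd := HD_spec v
    rcases hn : v.headI with _ | n
    · rw [hn] at h hd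
      refine thunk_zero hd ?_ (.lam _) ?_
      · simp [Closed, closedUnder, TL_closed.under, (encL_closed v).under,
          (compile_closed f).under]
      · simp only [subst, TL_closed.subst, (encL_closed v).subst, (compile_closed f).subst]
        exact app_eval (compile_val f) (TL_spec v) (ihf h)
    · rw [hn] at h hd
      refine thunk_succ hd (.lam _) ?_
      have : Steps (.app (compile g) (.app (.app CONS (scott n)) (.app TL (encL v)))) (encL w) :=
        app_eval (compile_val g) (CONS_eval Steps.refl (TL_spec v)) (ihg h)
      simpa [subst, TL_closed.subst, (encL_closed v).subst, (compile_closed g).subst,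
        CONS_closed.subst, (scott_closed n).shift, (scott_closed n).subst] using this
  | fix f ih =>
    simp only [Code.fix_eval] at h
    refine Steps.beta' (encL_val v) ?_
    have hW := fixW_closed (compile_closed f)
    simp only [subst, hW.subst, (encL_closed v).shift, reduceIte]
    refine (Steps.appL (fixW_self _) _).trans ?_
    refine PFun.fixInduction' (C := fun v => Steps (.app (fixL (compile f)) (encL v)) (encL w))
      h ?_ ?_
    · intro a ha
      simp only [Part.mem_map_iff] at ha
      obtain ⟨b, hb, hbw⟩ := ha
      split_ifs at hbw with h0
      cases hbw
      exact fix_unfold_zero (compile_closed f) (ih hb) h0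
    · intro a a' _ ha hC
      simp only [Part.mem_map_iff] at ha
      obtain ⟨b, hb, hbw⟩ := ha
      split_ifs at hbw with h0
      cases hbw
      exact fix_unfold_succ (compile_closed f) (ih hb) h0 hC

theorem representable {f : ℕ → ℕ} (hf : Computable f) :
    ∃ G : Term, G.Closed ∧ G.IsValue ∧ ∀ n, Steps (.app G (scott n)) (scott (f n)) := by
  have h1 : Nat.Partrec' (n := 1) (fun v => (f : ℕ →. ℕ) v.head) :=
    Nat.Partrec'.part_iff₁.2 hf
  obtain ⟨c, hc⟩ := Code.exists_code h1
  refine ⟨.lam (.app HD (.app (compile c) (.app (.app CONS (.var 0)) (encL [])))), ?_, .lam _, ?_⟩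
  · simp [Closed, closedUnder, HD_closed.under, CONS_closed.under, (compile_closed c).under,
      (encL_closed _).under]
  · intro n
    refine Steps.beta' (scott_val n) ?_
    simp only [subst, CONS_closed.subst, HD_closed.subst, (compile_closed _).subst,
      (encL_closed _).subst, (scott_closed n).shift, reduceIte]
    have h2 := hc (List.Vector.cons n List.Vector.nil)
    have h3 : [f n] ∈ c.eval [n] := by
      have h4 : (List.Vector.cons n List.Vector.nil).1 = [n] := rfl
      rw [h4] at h2
      rw [h2]
      simp
    exact HD_eval (app_eval (compile_val c) (CONS_spec n []) (compile_spec c h3))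


theorem RedV.not_value {M : Term} {Ns : List Term} (h : RedV M Ns) : ¬ M.IsValue := by
  intro hv
  cases h <;> cases hv

theorem RedV.det {M : Term} {Ns Ns' : List Term} (h : RedV M Ns) (h' : RedV M Ns') :
    Ns = Ns' := by
  induction h generalizing Ns' with
  | beta hV =>
    cases h' with
    | beta _ => rfl
    | appL h => exact absurd (.lam _) h.not_value
    | appR _ h => exact absurd hV h.not_value
  | choice hV hW =>
    cases h' with
    | choice _ _ => rfl
    | choiceL h => exact absurd hV h.not_value
    | choiceR _ h => exact absurd hW h.not_value
  | appL h ih =>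
    cases h' with
    | beta _ => exact absurd (.lam _) h.not_value
    | appL h' => rw [ih h']
    | appR hv _ => exact absurd hv h.not_value
  | appR hV h ih =>
    cases h' with
    | beta hv => exact absurd hv h.not_value
    | appL h' => exact absurd hV h'.not_value
    | appR _ h' => rw [ih h']
  | choiceL h ih =>
    cases h' with
    | choice hv _ => exact absurd hv h.not_value
    | choiceL h' => rw [ih h']
    | choiceR hv _ => exact absurd hv h.not_value
  | choiceR hV h ih =>
    cases h' with
    | choice _ hv => exact absurd hv h.not_value
    | choiceL h' => exact absurd hV h'.not_value
    | choiceR _ h' => rw [ih h']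

theorem conv_directed {M : Term} {D E : PDist} (hD : Conv RedV M D) (hE : Conv RedV M E) :
    ∃ F, Conv RedV M F ∧ (∀ W, D W ≤ F W) ∧ ∀ W, E W ≤ F W := by
  induction hD generalizing E with
  | bot M => exact ⟨E, hE, fun W => zero_le, fun W => le_rfl⟩
  | val hV =>
    cases hE with
    | bot => exact ⟨_, .val hV, fun W => le_rfl, fun W => zero_le⟩
    | val _ => exact ⟨_, .val hV, fun W => le_rfl, fun W => le_rfl⟩
    | step Ds h _ => exact absurd hV h.not_value
  | step Ds h hc ih =>
    cases hE with
    | bot => exact ⟨_, .step Ds h hc, fun W => le_rfl, fun W => zero_le⟩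
    | val hV => exact absurd hV h.not_value
    | step Es h' hc' =>
      cases h.det h'
      choose Fs hF hDF hEF using fun i => ih i (hc' i)
      refine ⟨_, .step Fs h hF, fun W => ?_, fun W => ?_⟩
      · exact ENNReal.div_le_div_right (Finset.sum_le_sum fun i _ => hDF i W) _
      · exact ENNReal.div_le_div_right (Finset.sum_le_sum fun i _ => hEF i W) _

theorem conv_mass {M : Term} {D : PDist} (hD : Conv RedV M D) : ∑' W, D W ≤ 1 := by
  induction hD with
  | bot M => simp [dzero]
  | val hV => simp [dirac]
  | @step M Ns Ds h hc ih =>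
    simp only [div_eq_mul_inv]
    rw [ENNReal.tsum_mul_right, Summable.tsum_finsetSum (fun _ _ => ENNReal.summable),
      ← div_eq_mul_inv]
    refine le_trans (ENNReal.div_le_div_right (Finset.sum_le_sum fun i _ => ih i) _) ?_
    simpa using ENNReal.div_self_le_one

theorem semV_mass (M : Term) : ∑' W, semV M W ≤ 1 := by
  rw [ENNReal.tsum_eq_iSup_sum]
  refine iSup_le fun s => ?_
  have : ∀ W, semV M W = ⨆ D : {D // Conv RedV M D}, D.1 W := by
    intro W
    rw [iSup_subtype]; rfl
  simp only [this]
  rw [ENNReal.finsetSum_iSup]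
  · refine iSup_le fun D => ?_
    exact (ENNReal.sum_le_tsum s).trans (conv_mass D.2)
  · intro D E
    obtain ⟨F, hF, h1, h2⟩ := conv_directed D.2 E.2
    exact ⟨⟨F, hF⟩, fun W => ⟨h1 W, h2 W⟩⟩

theorem scott_inj : Function.Injective scott := by
  intro m n h
  induction m generalizing n with
  | zero => cases n <;> simp_all [scott]
  | succ m ih =>
    cases n with
    | zero => simp [scott] at h
    | succ n => simp only [scott, Term.lam.injEq, Term.app.injEq, true_and] at h; rw [ih h]

theorem le_semV {M : Term} {D : PDist} (h : Conv RedV M D) (W : Term) : D W ≤ semV M W :=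
  le_iSup₂ (f := fun (D : PDist) (_ : SmallV M D) => D W) D h

theorem semV_value {V : Term} (h : V.IsValue) : 1 ≤ semV V V := by
  simpa [dirac] using le_semV (.val h) V

theorem semV_step {M N : Term} (h : RedV M [N]) (W : Term) : semV N W ≤ semV M W := by
  refine iSup₂_le fun D hD => ?_
  have := le_semV (Conv.step (fun _ => D) h (by intro i; fin_cases i; exact hD)) W
  simpa using this

theorem semV_steps {M N : Term} (h : Steps M N) (W : Term) : semV N W ≤ semV M W := by
  induction h with
  | refl => exact le_rfl
  | tail _ h ih => exact (semV_step h W).trans ih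

theorem semV_choice {M N N' : Term} (h : RedV M [N, N']) (W : Term) :
    (semV N W + semV N' W) / 2 ≤ semV M W := by
  have h2 : semV N W + semV N' W ≤ semV M W * 2 := by
    refine ENNReal.biSup_add_biSup_le' ⟨_, .bot N⟩ ⟨_, .bot N'⟩ fun D hD E hE => ?_
    have := le_semV (Conv.step (![D, E]) h
      (by intro i; fin_cases i; exacts [hD, hE])) W
    have h3 : (D W + E W) / 2 ≤ semV M W := by
      simpa [Fin.sum_univ_two] using this
    rwa [ENNReal.div_le_iff (by simp) (by simp)] at h3
  rwa [ENNReal.div_le_iff (by simp) (by simp)]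

/-- A lower bound with full mass determines the semantics. -/
theorem sem_of_lower {D : ℕ → ℝ≥0∞} (hprob : ∑' n, D n = 1) {M : Term}
    (h : ∀ n, D n ≤ semV M (scott n)) :
    (∀ V, semV M V ≠ 0 → ∃ n, V = scott n) ∧ ∀ n, semV M (scott n) = D n := by
  have hm := semV_mass M
  have hle : ∑' n, semV M (scott n) ≤ 1 :=
    (ENNReal.tsum_comp_le_tsum_of_injective scott_inj (semV M)).trans hm
  have heq : ∀ n, semV M (scott n) = D n := by
    by_contra! hne
    obtain ⟨n, hn⟩ := hne
    have hlt : D n < semV M (scott n) := lt_of_le_of_ne (h n) (Ne.symm hn)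
    have := ENNReal.tsum_lt_tsum (by rw [hprob]; simp) h hlt
    rw [hprob] at this
    exact absurd hle (not_le.2 this)
  refine ⟨fun V hV => ?_, heq⟩
  by_contra! hne
  have h1 : semV M V + ∑' W, ite (W = V) 0 (semV M W) ≤ 1 := by
    have h0 := hm
    rw [ENNReal.tsum_eq_add_tsum_ite V] at h0
    convert h0
  have h2 : ∑' n, semV M (scott n) ≤ ∑' W, ite (W = V) 0 (semV M W) := by
    refine le_trans (le_of_eq ?_) (ENNReal.tsum_comp_le_tsum_of_injective scott_inj _)
    refine tsum_congr fun n => ?_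
    rw [if_neg (fun e => hne n e.symm)]
  simp only [heq, hprob] at h2
  have h3 : semV M V + 1 ≤ 0 + 1 := by
    rw [zero_add]
    exact le_trans (add_le_add le_rfl h2) h1
  rw [ENNReal.add_le_add_iff_right (by simp)] at h3
  exact hV (le_antisymm h3 zero_le)


/-- Body of the sampling loop. -/
def loopB (O N0 N1 : Term) : Term :=
  .lam (.app (.app (.app (.app O (.var 0))
      (.lam (.app (.app (.var 2) (.var 2)) (.app (.choice N0 N1) (.var 1)))))
      (.lam (.lam (.var 1)))) IDT)

/-- Functional of the sampling loop. -/
def loopW (O N0 N1 : Term) : Term := .lam (loopB O N0 N1)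

/-- The sampling loop. -/
def loopL (O N0 N1 : Term) : Term := (loopB O N0 N1).subst 0 (loopW O N0 N1)

theorem loopW_closed {O N0 N1 : Term} (hO : O.Closed) (h0 : N0.Closed) (h1 : N1.Closed) :
    (loopW O N0 N1).Closed := by
  simp [loopW, loopB, Closed, closedUnder, hO.under, h0.under, h1.under, IDT_closed.under]

theorem loop_out {O N0 N1 : Term} (hO : O.Closed) {s a : ℕ} (h : Steps (.app O (scott s)) (scott (a + 1))) :
    Steps (.app (loopL O N0 N1) (scott s)) (scott a) := by
  refine Steps.beta' (scott_val s) ?_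
  simp only [subst]
  refine thunk_succ (n := a) ?_ (.lam _) ?_
  · simpa [subst, hO.subst, (scott_closed s).shift] using h
  · simp [subst, (scott_closed a).shift, (scott_closed a).subst, Steps.refl]

theorem loop_flip {O N0 N1 : Term} (hO : O.Closed) (h0 : N0.Closed) (h1 : N1.Closed)
    {s : ℕ} (h : Steps (.app O (scott s)) (scott 0)) :
    Steps (.app (loopL O N0 N1) (scott s))
      (.app (loopL O N0 N1) (.app (.choice N0 N1) (scott s))) := by
  have hW := loopW_closed hO h0 h1
  refine Steps.beta' (scott_val s) ?_
  simp only [subst]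
  refine thunk_zero ?_ ?_ (.lam _) ?_
  · simpa [subst, hO.subst, (scott_closed s).shift] using h
  · simp [Closed, closedUnder, subst, hW.shift, hW.subst, h0.subst, h1.subst, hW.under,
      h0.under, h1.under, (scott_closed s).shift, (scott_closed s).under]
  · have : Steps (.app (.app (loopW O N0 N1) (loopW O N0 N1)) (.app (.choice N0 N1) (scott s)))
        (.app (loopL O N0 N1) (.app (.choice N0 N1) (scott s))) :=
      Steps.appL (Steps.beta (.lam _)) _
    simpa [subst, hW.shift, hW.subst, h0.subst, h1.subst, (scott_closed s).shift,
      (scott_closed s).subst] using this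

theorem loop_sem_out {O N0 N1 : Term} (hO : O.Closed) {s a : ℕ} (h : Steps (.app O (scott s)) (scott (a + 1))) :
    1 ≤ semV (.app (loopL O N0 N1) (scott s)) (scott a) :=
  (semV_value (scott_val a)).trans (semV_steps (loop_out hO h) _)

theorem loop_sem_flip {O N0 N1 : Term} (hO : O.Closed) (h0 : N0.Closed) (h1 : N1.Closed)
    (v0 : N0.IsValue) (v1 : N1.IsValue) {s t u : ℕ} (h : Steps (.app O (scott s)) (scott 0))
    (ht : Steps (.app N0 (scott s)) (scott t)) (hu : Steps (.app N1 (scott s)) (scott u))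
    (W : Term) :
    (semV (.app (loopL O N0 N1) (scott t)) W + semV (.app (loopL O N0 N1) (scott u)) W) / 2
      ≤ semV (.app (loopL O N0 N1) (scott s)) W := by
  refine le_trans ?_ (semV_steps (loop_flip hO h0 h1 h) W)
  have hr : RedV (.app (loopL O N0 N1) (.app (.choice N0 N1) (scott s)))
      [.app (loopL O N0 N1) (.app N0 (scott s)), .app (loopL O N0 N1) (.app N1 (scott s))] :=
    RedV.appR (.lam _) (RedV.appL (RedV.choice v0 v1))
  refine le_trans ?_ (semV_choice hr W)
  refine ENNReal.div_le_div_right (add_le_add ?_ ?_) _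
  · exact semV_steps (Steps.appR (.lam _) ht) W
  · exact semV_steps (Steps.appR (.lam _) hu) W

theorem loopL_closed {O N0 N1 : Term} (hO : O.Closed) (h0 : N0.Closed) (h1 : N1.Closed) :
    (loopL O N0 N1).Closed := by
  have hW := loopW_closed hO h0 h1
  simp [loopL, loopB, subst, Closed, closedUnder, hO.subst, h0.subst, h1.subst, hW.shift,
    hO.under, h0.under, h1.under, hW.under, IDT_closed.under, IDT_closed.subst]


theorem sum_range_two_mul (g : ℕ → ℝ≥0∞) (q : ℕ) :
    ∑ r ∈ Finset.range (2 * q), g r = ∑ x ∈ Finset.range q, (g (2 * x) + g (2 * x + 1)) := by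
  induction q with
  | zero => simp
  | succ q ih =>
    rw [Nat.mul_succ, Finset.sum_range_succ, Finset.sum_range_succ, ih, Finset.sum_range_succ,
      add_assoc]

/-- Number of undecided nodes at each level. -/
def undec (wt : ℕ → ℕ) : ℕ → ℕ
  | 0 => 1
  | n + 1 => 2 * (undec wt n - wt n)

theorem undec_spec (wt : ℕ → ℕ) (hw : ∑' t, (wt t : ℝ≥0∞) / 2 ^ t ≤ 1) (n : ℕ) :
    wt n ≤ undec wt n ∧
      (undec wt n : ℝ≥0∞) / 2 ^ n + ∑ t ∈ Finset.range n, (wt t : ℝ≥0∞) / 2 ^ t = 1 := by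
  have aux : ∀ n, (undec wt n : ℝ≥0∞) / 2 ^ n
      + ∑ t ∈ Finset.range n, (wt t : ℝ≥0∞) / 2 ^ t = 1 → wt n ≤ undec wt n := by
    intro n h
    have h1 : ∑ t ∈ Finset.range (n + 1), (wt t : ℝ≥0∞) / 2 ^ t ≤ 1 :=
      (ENNReal.sum_le_tsum _).trans hw
    rw [← h, Finset.sum_range_succ, add_comm] at h1
    have hfin : ∑ t ∈ Finset.range n, (wt t : ℝ≥0∞) / 2 ^ t ≠ ⊤ := by
      refine ne_top_of_le_ne_top ENNReal.one_ne_top ((ENNReal.sum_le_tsum _).trans hw)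
    rw [ENNReal.add_le_add_iff_right hfin] at h1
    have h2 := (ENNReal.div_le_iff (by simp) (by simp)).1 h1
    rw [ENNReal.div_mul_cancel (by simp) (by simp)] at h2
    exact_mod_cast h2
  suffices h : (undec wt n : ℝ≥0∞) / 2 ^ n
      + ∑ t ∈ Finset.range n, (wt t : ℝ≥0∞) / 2 ^ t = 1 from ⟨aux n h, h⟩
  induction n with
  | zero => simp [undec]
  | succ n ih =>
    obtain ⟨q, hq⟩ := Nat.exists_eq_add_of_le (aux n ih)
    rw [Finset.sum_range_succ, undec, hq, Nat.add_sub_cancel_left]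
    rw [hq] at ih
    rw [← ih]
    push_cast
    rw [pow_succ, mul_comm (2 : ℝ≥0∞) q, ENNReal.mul_div_mul_right _ _ (by simp) (by simp),
      ENNReal.add_div]
    ring

theorem lower_bound (wt lab : ℕ → ℕ) (a : ℕ) (V : ℕ → ℕ → ℝ≥0∞)
    (hw : ∑' t, (wt t : ℝ≥0∞) / 2 ^ t ≤ 1)
    (h1 : ∀ n r, r < wt n → lab n = a → 1 ≤ V n r)
    (h2 : ∀ n r, (V (n + 1) (2 * r) + V (n + 1) (2 * r + 1)) / 2 ≤ V n (wt n + r)) :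
    ∑' t, (if lab t = a then (wt t : ℝ≥0∞) / 2 ^ t else 0) ≤ V 0 0 := by
  have key : ∀ K, ∑ t ∈ Finset.range K, (if lab t = a then (wt t : ℝ≥0∞) / 2 ^ t else 0)
      + (∑ r ∈ Finset.range (undec wt K), V K r) / 2 ^ K ≤ V 0 0 := by
    intro K
    induction K with
    | zero => simp [undec]
    | succ K ih =>
      refine le_trans ?_ ih
      obtain ⟨q, hq⟩ := Nat.exists_eq_add_of_le (undec_spec wt hw K).1
      rw [Finset.sum_range_succ, add_assoc]
      refine add_le_add le_rfl ?_
      rw [undec, hq, Nat.add_sub_cancel_left, Finset.sum_range_add, sum_range_two_mul,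
        ENNReal.add_div]
      refine add_le_add ?_ ?_
      · split_ifs with h
        · refine ENNReal.div_le_div_right ?_ _
          calc (wt K : ℝ≥0∞) = ∑ r ∈ Finset.range (wt K), 1 := by simp
            _ ≤ _ := Finset.sum_le_sum fun r hr => h1 K r (Finset.mem_range.1 hr) h
        · exact zero_le
      · have : (∑ x ∈ Finset.range q, (V (K + 1) (2 * x) + V (K + 1) (2 * x + 1))) / 2 ^ (K + 1)
            = (∑ x ∈ Finset.range q, (V (K + 1) (2 * x) + V (K + 1) (2 * x + 1)) / 2) / 2 ^ K := by
          simp only [div_eq_mul_inv]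
          rw [← Finset.sum_mul, mul_assoc, pow_succ, ENNReal.mul_inv (by simp) (by simp),
            mul_comm (2⁻¹ : ℝ≥0∞)]
        rw [this]
        exact ENNReal.div_le_div_right (Finset.sum_le_sum fun x _ => h2 K x) _
  rw [ENNReal.tsum_eq_iSup_nat]
  exact iSup_le fun K => le_trans le_self_add (key K)

theorem expansion {x : ℝ≥0∞} (hx : x < 1) :
    ∑' i : ℕ, (if ⌊x.toReal * 2 ^ (i + 1)⌋ % 2 = 1 then ((2 : ℝ≥0∞) ^ (i + 1))⁻¹ else 0) = x := by
  have hx' : x.toReal ∈ Set.Ico (0 : ℝ) 1 := by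
    refine ⟨ENNReal.toReal_nonneg, ?_⟩
    have := (ENNReal.toReal_lt_toReal hx.ne_top ENNReal.one_ne_top).2 hx
    simpa using this
  have h := Real.hasSum_ofDigitsTerm_digits x.toReal (b := 2) (by norm_num) hx'
  have h2 := h.tsum_eq
  have h3 : ∑' i, ENNReal.ofReal (Real.ofDigitsTerm (Real.digits x.toReal 2) i) = x := by
    rw [← ENNReal.ofReal_tsum_of_nonneg (fun i => Real.ofDigitsTerm_nonneg) h.summable, h2,
      ENNReal.ofReal_toReal hx.ne_top]
  refine Eq.trans (tsum_congr fun i => ?_) h3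
  have hn : (0 : ℝ) ≤ x.toReal * 2 ^ (i + 1) := by positivity
  have e : ⌊x.toReal * 2 ^ (i + 1)⌋ = (⌊x.toReal * 2 ^ (i + 1)⌋₊ : ℤ) :=
    (Int.natCast_floor_eq_floor hn).symm
  rw [e]
  generalize hk : ⌊x.toReal * 2 ^ (i + 1)⌋₊ = k
  have e2 : ((Real.digits x.toReal 2 i : Fin 2) : ℕ) = k % 2 := by
    simp [Real.digits, hk]
  rw [Real.ofDigitsTerm, e2]
  rcases Nat.mod_two_eq_zero_or_one k with h0 | h0
  · rw [if_neg (by omega), h0]; simp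
  · rw [if_pos (by omega), h0]
    simp [ENNReal.ofReal_inv_of_pos, ENNReal.ofReal_pow]

/-- Bits of the distribution, extracted from the approximating function. -/
noncomputable def dbit (D : ℕ → ℝ≥0∞) (p : ℕ × ℕ) : Bool :=
  ((binApprox (D p.1) (p.2 + 1))[p.2]?).getD false

theorem dbit_eq (D : ℕ → ℝ≥0∞) (p : ℕ × ℕ) :
    dbit D p = decide (⌊(D p.1).toReal * 2 ^ (p.2 + 1)⌋ % 2 = 1) := by
  simp [dbit, binApprox]

theorem getBit_computable {g : ℕ × ℕ → List Bool} (h1 : Computable g) :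
    Computable fun p : ℕ × ℕ => ((g p)[p.2]?).getD false := by
  have h2 : Computable fun p : ℕ × ℕ => (g p)[p.2]? :=
    Computable.list_getElem?.comp h1 Computable.snd
  exact Computable.option_getD h2 (Computable.const false)

theorem shift_computable {g : ℕ × ℕ → List Bool} (h : Computable g) :
    Computable fun p : ℕ × ℕ => g (p.1, p.2 + 1) := by
  have h2 : Computable fun p : ℕ × ℕ => (p.1, p.2 + 1) :=
    Computable.fst.pair (Computable.succ.comp Computable.snd)
  exact h.comp h2

theorem dbit_computable {D : ℕ → ℝ≥0∞} (h : ComputableDist D) : Computable (dbit D) := by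
  unfold ComputableDist at h
  have h1 := shift_computable h
  exact getBit_computable h1

/-- Weight (scaled by a power of two) treated at a given level. -/
noncomputable def wtF (D : ℕ → ℝ≥0∞) (n : ℕ) : ℕ :=
  bif decide (n ≠ 0) && dbit D (n - 1).unpair then 2 ^ (n - 1 - (n - 1).unpair.2) else 0

/-- Label treated at a given level. -/
def labF (n : ℕ) : ℕ := (n - 1).unpair.1

theorem wt_sum (D : ℕ → ℝ≥0∞) (g : ℕ → ℝ≥0∞) :
    ∑' t, g (labF t) * ((wtF D t : ℝ≥0∞) / 2 ^ t) =
    ∑' a, g a * ∑' i : ℕ, (if ⌊(D a).toReal * 2 ^ (i + 1)⌋ % 2 = 1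
      then ((2 : ℝ≥0∞) ^ (i + 1))⁻¹ else 0) := by
  rw [tsum_eq_zero_add' ENNReal.summable]
  have h0 : wtF D 0 = 0 := by simp [wtF]
  rw [h0]
  simp only [Nat.cast_zero, ENNReal.zero_div, mul_zero, zero_add, ← ENNReal.tsum_mul_left]
  rw [← ENNReal.tsum_prod (f := fun a i => g a * (if ⌊(D a).toReal * 2 ^ (i + 1)⌋ % 2 = 1
      then ((2 : ℝ≥0∞) ^ (i + 1))⁻¹ else 0)), ← Nat.pairEquiv.symm.tsum_eq]
  refine tsum_congr fun m => ?_
  simp only [labF, Nat.add_sub_cancel, Nat.pairEquiv_symm_apply, wtF, dbit_eq]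
  congr 1
  by_cases h : ⌊(D m.unpair.1).toReal * 2 ^ (m.unpair.2 + 1)⌋ % 2 = 1
  · simp only [h, ne_eq, Nat.add_eq_zero_iff, one_ne_zero, and_false, not_false_eq_true,
      decide_true, Bool.and_self, cond_true, if_true]
    have hle := Nat.unpair_right_le m
    obtain ⟨q, hq⟩ := Nat.exists_eq_add_of_le hle
    have e : m - m.unpair.2 = q := by omega
    have e2 : m + 1 = q + (m.unpair.2 + 1) := by omega
    rw [e, e2, pow_add, Nat.cast_pow, Nat.cast_ofNat, div_eq_mul_inv,
      ENNReal.mul_inv (by simp) (by simp), ← mul_assoc, ENNReal.mul_inv_cancel (by simp) (by simp),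
      one_mul]
  · simp [h]

/-- Output function of the sampler. -/
noncomputable def outF (D : ℕ → ℝ≥0∞) (s : ℕ) : ℕ :=
  bif decide (s.unpair.2 < wtF D s.unpair.1) then labF s.unpair.1 + 1 else 0

/-- Transition function of the sampler. -/
noncomputable def nxF (D : ℕ → ℝ≥0∞) (c s : ℕ) : ℕ :=
  Nat.pair (s.unpair.1 + 1) (2 * (s.unpair.2 - wtF D s.unpair.1) + c)

theorem labF_primrec : Primrec labF :=
  Primrec.fst.comp (Primrec.unpair.comp Primrec.pred)

theorem pow2_primrec : Primrec (fun n : ℕ => 2 ^ n) := by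
  have : Primrec (fun n : ℕ => Nat.rec (motive := fun _ => ℕ) 1 (fun _ k => 2 * k) n) :=
    Primrec.nat_rec₁ 1 (Primrec.nat_mul.comp (Primrec.const 2) Primrec.snd).to₂
  refine this.of_eq fun n => ?_
  induction n with
  | zero => rfl
  | succ n ih => simp only [] at *; rw [pow_succ, ← ih]; ring

theorem wtF_computable {D : ℕ → ℝ≥0∞} (h : ComputableDist D) : Computable (wtF D) := by
  have hu : Computable (fun n : ℕ => (n - 1).unpair) :=
    (Primrec.unpair.comp Primrec.pred).to_comp
  have hb : Computable (fun n : ℕ => dbit D (n - 1).unpair) := (dbit_computable h).comp hu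
  have hd : Computable (fun n : ℕ => decide (n ≠ 0)) := by
    have : PrimrecPred (fun n : ℕ => n ≠ 0) := (Primrec.eq.comp Primrec.id (Primrec.const 0)).not
    exact this.decide.to_comp
  have hp : Computable (fun n : ℕ => 2 ^ (n - 1 - (n - 1).unpair.2)) :=
    (pow2_primrec.comp (Primrec.nat_sub.comp Primrec.pred
      (Primrec.snd.comp (Primrec.unpair.comp Primrec.pred)))).to_comp
  exact Computable.cond ((Primrec.and.to_comp).comp hd hb) hp (Computable.const 0)

theorem outF_computable {D : ℕ → ℝ≥0∞} (h : ComputableDist D) : Computable (outF D) := by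
  have h1 : Computable (fun s : ℕ => s.unpair.1) := (Primrec.fst.comp Primrec.unpair).to_comp
  have h2 : Computable (fun s : ℕ => s.unpair.2) := (Primrec.snd.comp Primrec.unpair).to_comp
  have hlt : Computable₂ (fun a b : ℕ => decide (a < b)) := Primrec.nat_lt.decide.to_comp
  exact Computable.cond (hlt.comp h2 ((wtF_computable h).comp h1))
    (Computable.succ.comp (labF_primrec.to_comp.comp h1)) (Computable.const 0)

theorem nxF_computable {D : ℕ → ℝ≥0∞} (h : ComputableDist D) (c : ℕ) : Computable (nxF D c) := by
  have h1 : Computable (fun s : ℕ => s.unpair.1) := (Primrec.fst.comp Primrec.unpair).to_comp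
  have h2 : Computable (fun s : ℕ => s.unpair.2) := (Primrec.snd.comp Primrec.unpair).to_comp
  have hs := Primrec.nat_sub.to_comp.comp h2 ((wtF_computable h).comp h1)
  have hm := Primrec.nat_mul.to_comp.comp (Computable.const 2) hs
  have ha := Primrec.nat_add.to_comp.comp hm (Computable.const c)
  exact Primrec₂.natPair.to_comp.comp (Computable.succ.comp h1) ha

/-- Completeness: every computable probability distribution
over the natural numbers is representable. -/
theorem computable_representable (D : ℕ → ℝ≥0∞) (hprob : ∑' n, D n = 1)
    (hcomp : ComputableDist D) :
    ∃ M : Term, M.Closed ∧ (∀ V, semV M V ≠ 0 → ∃ n, V = scott n) ∧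
      ∀ n, semV M (scott n) = D n := by
  have hle : ∀ n, D n ≤ 1 := fun n => hprob ▸ ENNReal.le_tsum n
  by_cases hone : ∃ a, D a = 1
  · obtain ⟨a, ha⟩ := hone
    refine ⟨scott a, scott_closed a, sem_of_lower hprob fun n => ?_⟩
    by_cases hn : n = a
    · subst hn
      rw [ha]
      exact semV_value (scott_val n)
    · have h1 : D a + D n ≤ 1 := by
        rw [← hprob, ← Finset.sum_pair (fun e => hn e.symm)]
        exact ENNReal.sum_le_tsum _
      rw [ha] at h1
      have h2 : 1 + D n ≤ 1 + 0 := by simpa using h1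
      rw [ENNReal.add_le_add_iff_left (by simp)] at h2
      exact h2.trans zero_le
  · push Not at hone
    have hlt : ∀ n, D n < 1 := fun n => lt_of_le_of_ne (hle n) (hone n)
    obtain ⟨O, hO, _, sO⟩ := representable (outF_computable hcomp)
    obtain ⟨N0, h0, v0, s0⟩ := representable (nxF_computable hcomp 0)
    obtain ⟨N1, h1, v1, s1⟩ := representable (nxF_computable hcomp 1)
    refine ⟨.app (loopL O N0 N1) (scott (Nat.pair 0 0)),
      ⟨loopL_closed hO h0 h1, scott_closed _⟩, sem_of_lower hprob fun a => ?_⟩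
    have hw : ∑' t, (wtF D t : ℝ≥0∞) / 2 ^ t ≤ 1 := by
      have := wt_sum D (fun _ => 1)
      simp only [one_mul, expansion (hlt _), hprob] at this
      exact this.le
    have hD : ∑' t, (if labF t = a then (wtF D t : ℝ≥0∞) / 2 ^ t else 0) = D a := by
      have := wt_sum D (fun b => if b = a then 1 else 0)
      simp only [expansion (hlt _), ite_mul, one_mul, zero_mul, tsum_ite_eq] at this
      exact this
    rw [← hD]
    refine lower_bound (wtF D) labF a
      (fun n r => semV (.app (loopL O N0 N1) (scott (Nat.pair n r))) (scott a)) hw ?_ ?_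
    · intro n r hr hl
      refine loop_sem_out hO ?_
      have := sO (Nat.pair n r)
      simpa [outF, hr, hl] using this
    · intro n r
      refine loop_sem_flip hO h0 h1 v0 v1 ?_ ?_ ?_ _
      · have := sO (Nat.pair n (wtF D n + r))
        simpa [outF] using this
      · have := s0 (Nat.pair n (wtF D n + r))
        simpa [nxF] using this
      · have := s1 (Nat.pair n (wtF D n + r))
        simpa [nxF] using this
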